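/- arXiv:2009.01675 — 6 statements merged into one kernel-verified Lean document; each statement's English description precedes it below -/
import Mathlib

section
/- Let ν ≥ 0, t > 0 be real numbers and let g : ℝ → ℝ be differentiable. Define F : ℝ × ℝ → ℝ × ℝ by F(K, Φ) = (K₊, Φ₊) where K₁ = e^{−νt/2}·K, Φ₁ = Φ − (t/2)·K₁, K₂ = K₁ + t·g(Φ₁), K₊ = e^{−νt/2}·K₂, Φ₊ = Φ₁ + (t/2)·K₂. Then at every point (K, Φ) the Jacobian determinant of F, namely (∂Φ₊/∂Φ)(∂K₊/∂K) − (∂Φ₊/∂K)(∂K₊/∂Φ), equals e^{−νt}. -/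
open Real

/-- Velocity component `K₊` of the deterministic quasi-symplectic Langevin
integrator step (scalar case): `K₁ = e^{−νt/2}·K`, `Φ₁ = Φ − (t/2)·K₁`,
`K₂ = K₁ + t·g(Φ₁)`, `K₊ = e^{−νt/2}·K₂`. -/
noncomputable def qslKplus (ν t : ℝ) (g : ℝ → ℝ) (K Φ : ℝ) : ℝ :=
  exp (-ν * t / 2) *
    (exp (-ν * t / 2) * K + t * g (Φ - t / 2 * (exp (-ν * t / 2) * K)))

/-- Position component `Φ₊` of the deterministic quasi-symplectic Langevin
integrator step (scalar case): `Φ₊ = Φ₁ + (t/2)·K₂`. -/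
noncomputable def qslPhiplus (ν t : ℝ) (g : ℝ → ℝ) (K Φ : ℝ) : ℝ :=
  (Φ - t / 2 * (exp (-ν * t / 2) * K)) +
    t / 2 *
      (exp (-ν * t / 2) * K + t * g (Φ - t / 2 * (exp (-ν * t / 2) * K)))

/-- Derivative of the velocity component along a differentiable curve in phase space. -/
theorem hasDerivAt_qslKplus {ν t : ℝ} {g k φ : ℝ → ℝ} (hg : Differentiable ℝ g)
    {x k' φ' : ℝ} (hk : HasDerivAt k k' x) (hφ : HasDerivAt φ φ' x) :
    HasDerivAt (fun y => qslKplus ν t g (k y) (φ y))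
      (exp (-ν * t / 2) * (exp (-ν * t / 2) * k' +
        t * (deriv g (φ x - t / 2 * (exp (-ν * t / 2) * k x)) *
          (φ' - t / 2 * (exp (-ν * t / 2) * k'))))) x := by
  have hΦ := hφ.sub ((hk.const_mul (exp (-ν * t / 2))).const_mul (t / 2))
  have hG := (hg (φ x - t / 2 * (exp (-ν * t / 2) * k x))).hasDerivAt.comp x hΦ
  exact ((hk.const_mul _).add (hG.const_mul t)).const_mul _

/-- Derivative of the position component along a differentiable curve in phase space. -/
theorem hasDerivAt_qslPhiplus {ν t : ℝ} {g k φ : ℝ → ℝ} (hg : Differentiable ℝ g)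
    {x k' φ' : ℝ} (hk : HasDerivAt k k' x) (hφ : HasDerivAt φ φ' x) :
    HasDerivAt (fun y => qslPhiplus ν t g (k y) (φ y))
      (φ' - t / 2 * (exp (-ν * t / 2) * k') +
        t / 2 * (exp (-ν * t / 2) * k' +
          t * (deriv g (φ x - t / 2 * (exp (-ν * t / 2) * k x)) *
            (φ' - t / 2 * (exp (-ν * t / 2) * k'))))) x := by
  have hΦ := hφ.sub ((hk.const_mul (exp (-ν * t / 2))).const_mul (t / 2))
  have hG := (hg (φ x - t / 2 * (exp (-ν * t / 2) * k x))).hasDerivAt.comp x hΦ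
  exact hΦ.add (((hk.const_mul _).add (hG.const_mul t)).const_mul _)

/-- Theorem 2 (scalar case): the Jacobian determinant of the quasi-symplectic
Langevin step equals `e^{−νt}` at every point. -/
theorem qsl_jacobian_det_scalar (ν t : ℝ) (hν : 0 ≤ ν) (ht : 0 < t)
    (g : ℝ → ℝ) (hg : Differentiable ℝ g) (K Φ : ℝ) :
    deriv (fun Φ' => qslPhiplus ν t g K Φ') Φ *
        deriv (fun K' => qslKplus ν t g K' Φ) K -
      deriv (fun K' => qslPhiplus ν t g K' Φ) K *
        deriv (fun Φ' => qslKplus ν t g K Φ') Φ = exp (-(ν * t)) := by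
  have hexp : exp (-(ν * t)) = exp (-ν * t / 2) * exp (-ν * t / 2) := by
    rw [← exp_add]
    ring_nf
  rw [(hasDerivAt_qslPhiplus hg (hasDerivAt_const Φ K) (hasDerivAt_id' Φ)).deriv,
    (hasDerivAt_qslKplus hg (hasDerivAt_id' K) (hasDerivAt_const K Φ)).deriv,
    (hasDerivAt_qslPhiplus hg (hasDerivAt_id' K) (hasDerivAt_const K Φ)).deriv,
    (hasDerivAt_qslKplus hg (hasDerivAt_const Φ K) (hasDerivAt_id' Φ)).deriv, hexp]
  ring
end

section
/- Let ν ≥ 0, t > 0 be real numbers, d ≥ 1 an integer, and let g : ℝ^d → ℝ^d be continuously differentiable. Define F : ℝ^d × ℝ^d → ℝ^d × ℝ^d by F(K, Φ) = (K₊, Φ₊) where K₁ = e^{−νt/2}·K, Φ₁ = Φ − (t/2)·K₁, K₂ = K₁ + t·g(Φ₁), K₊ = e^{−νt/2}·K₂, Φ₊ = Φ₁ + (t/2)·K₂. Then F is differentiable and for every point z ∈ ℝ^d × ℝ^d the determinant of the total derivative of F at z (as a linear endomorphism of ℝ^d × ℝ^d) equals exp(−ν t d). -/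
/-- The deterministic quasi-symplectic Langevin integrator step with damping `ν`,
time step `t` and force field `g`, on phase space `ℝ^d × ℝ^d` (velocity `K`,
position `Φ`): `K₁ = e^{−νt/2}•K`, `Φ₁ = Φ − (t/2)•K₁`, `K₂ = K₁ + t•g(Φ₁)`,
`K₊ = e^{−νt/2}•K₂`, `Φ₊ = Φ₁ + (t/2)•K₂`. -/
noncomputable def qslStep (d : ℕ) (ν t : ℝ)
    (g : EuclideanSpace ℝ (Fin d) → EuclideanSpace ℝ (Fin d)) :
    EuclideanSpace ℝ (Fin d) × EuclideanSpace ℝ (Fin d) →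
      EuclideanSpace ℝ (Fin d) × EuclideanSpace ℝ (Fin d) :=
  fun z =>
    let K₁ := Real.exp (-ν * t / 2) • z.1
    let Φ₁ := z.2 - (t / 2) • K₁
    let K₂ := K₁ + t • g Φ₁
    (Real.exp (-ν * t / 2) • K₂, Φ₁ + (t / 2) • K₂)

/-- The shear `(x, y) ↦ (x, y + f x)` has determinant one. -/
theorem LinearMap.det_prod_fst_snd_add_comp_fst {R M N : Type*} [CommRing R]
    [AddCommGroup M] [Module R M] [Module.Free R M] [Module.Finite R M]
    [AddCommGroup N] [Module R N] [Module.Free R N] [Module.Finite R N] (f : M →ₗ[R] N) :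
    LinearMap.det ((LinearMap.fst R M N).prod (LinearMap.snd R M N + f ∘ₗ LinearMap.fst R M N)) =
      1 := by
  classical
  let b := Module.Free.chooseBasis R M
  let c := Module.Free.chooseBasis R N
  have h : LinearMap.toMatrix (b.prod c) (b.prod c)
      ((LinearMap.fst R M N).prod (LinearMap.snd R M N + f ∘ₗ LinearMap.fst R M N)) =
      Matrix.fromBlocks 1 0 (LinearMap.toMatrix b c f) 1 := by
    ext (i | i) (j | j) <;>
      simp [LinearMap.toMatrix_apply, Matrix.one_apply, Finsupp.single_apply, eq_comm]
  rw [← LinearMap.det_toMatrix (b.prod c), h, Matrix.det_fromBlocks_zero₁₂]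
  simp

/-- The shear `(x, y) ↦ (x + f y, y)` has determinant one. -/
theorem LinearMap.det_prod_fst_add_comp_snd_snd {R M N : Type*} [CommRing R]
    [AddCommGroup M] [Module R M] [Module.Free R M] [Module.Finite R M]
    [AddCommGroup N] [Module R N] [Module.Free R N] [Module.Finite R N] (f : N →ₗ[R] M) :
    LinearMap.det ((LinearMap.fst R M N + f ∘ₗ LinearMap.snd R M N).prod (LinearMap.snd R M N)) =
      1 := by
  classical
  let b := Module.Free.chooseBasis R M
  let c := Module.Free.chooseBasis R N
  have h : LinearMap.toMatrix (b.prod c) (b.prod c)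
      ((LinearMap.fst R M N + f ∘ₗ LinearMap.snd R M N).prod (LinearMap.snd R M N)) =
      Matrix.fromBlocks 1 (LinearMap.toMatrix c b f) 0 1 := by
    ext (i | i) (j | j) <;>
      simp [LinearMap.toMatrix_apply, Matrix.one_apply, Finsupp.single_apply, eq_comm]
  rw [← LinearMap.det_toMatrix (b.prod c), h, Matrix.det_fromBlocks_zero₂₁]
  simp

theorem exists_hasFDerivAt_qslStep (d : ℕ) (ν t : ℝ)
    {g : EuclideanSpace ℝ (Fin d) → EuclideanSpace ℝ (Fin d)} (hg : Differentiable ℝ g)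
    (z : EuclideanSpace ℝ (Fin d) × EuclideanSpace ℝ (Fin d)) :
    ∃ (D : EuclideanSpace ℝ (Fin d) × EuclideanSpace ℝ (Fin d) →L[ℝ]
        EuclideanSpace ℝ (Fin d) × EuclideanSpace ℝ (Fin d))
      (G : EuclideanSpace ℝ (Fin d) →L[ℝ] EuclideanSpace ℝ (Fin d)),
      HasFDerivAt (qslStep d ν t g) D z ∧
      ∀ k φ, D (k, φ) =
        (Real.exp (-ν * t / 2) • (Real.exp (-ν * t / 2) • k +
            t • G (φ - (t / 2) • Real.exp (-ν * t / 2) • k)),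
          (φ - (t / 2) • Real.exp (-ν * t / 2) • k) + (t / 2) • (Real.exp (-ν * t / 2) • k +
            t • G (φ - (t / 2) • Real.exp (-ν * t / 2) • k))) := by
  have hK₁ := (hasFDerivAt_fst (𝕜 := ℝ) (p := z)).const_smul (Real.exp (-ν * t / 2))
  have hΦ₁ := (hasFDerivAt_snd (𝕜 := ℝ) (p := z)).sub (hK₁.const_smul (t / 2))
  have hgΦ₁ := (hg (z.2 - (t / 2) • Real.exp (-ν * t / 2) • z.1)).hasFDerivAt.comp z hΦ₁
  have hK₂ := hK₁.add (hgΦ₁.const_smul t)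
  exact ⟨_, _, (hK₂.const_smul (Real.exp (-ν * t / 2))).prodMk
    (hΦ₁.add (hK₂.const_smul (t / 2))), fun _ _ => rfl⟩

/-- Theorem 2 (d dimensions): the quasi-symplectic Langevin step is differentiable
with constant Jacobian determinant `exp(−ν t d)`. -/
theorem qsl_jacobian_det (d : ℕ) (hd : 1 ≤ d) (ν t : ℝ) (hν : 0 ≤ ν) (ht : 0 < t)
    (g : EuclideanSpace ℝ (Fin d) → EuclideanSpace ℝ (Fin d)) (hg : ContDiff ℝ 1 g) :
    Differentiable ℝ (qslStep d ν t g) ∧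
      ∀ z : EuclideanSpace ℝ (Fin d) × EuclideanSpace ℝ (Fin d),
        LinearMap.det (fderiv ℝ (qslStep d ν t g) z).toLinearMap =
          Real.exp (-(ν * t * d)) := by
  have hg' : Differentiable ℝ g := hg.differentiable one_ne_zero
  refine ⟨fun z => ?_, fun z => ?_⟩
  · obtain ⟨_, _, hD, -⟩ := exists_hasFDerivAt_qslStep d ν t hg' z
    exact hD.differentiableAt
  obtain ⟨D, G, hD, hDG⟩ := exists_hasFDerivAt_qslStep d ν t hg' z
  let E := EuclideanSpace ℝ (Fin d)
  let scale : E × E →ₗ[ℝ] E × E :=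
    (Real.exp (-ν * t / 2) • (LinearMap.id : E →ₗ[ℝ] E)).prodMap LinearMap.id
  let drift (s : ℝ) : E × E →ₗ[ℝ] E × E := (LinearMap.fst ℝ E E).prod
    (LinearMap.snd ℝ E E + (s • (LinearMap.id : E →ₗ[ℝ] E)) ∘ₗ LinearMap.fst ℝ E E)
  let kick : E × E →ₗ[ℝ] E × E := (LinearMap.fst ℝ E E +
    (t • G.toLinearMap) ∘ₗ LinearMap.snd ℝ E E).prod (LinearMap.snd ℝ E E)
  have hfactor : D.toLinearMap =
      scale ∘ₗ drift (t / 2) ∘ₗ kick ∘ₗ drift (-(t / 2)) ∘ₗ scale := by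
    refine LinearMap.ext fun ⟨k, φ⟩ => (hDG k φ).trans ?_
    simp [scale, drift, kick, sub_eq_add_neg]
  have hscale : LinearMap.det scale = Real.exp (-ν * t / 2) ^ d := by
    simp [scale, E, LinearMap.det_prodMap, LinearMap.det_smul]
  have hdrift (s : ℝ) : LinearMap.det (drift s) = 1 :=
    LinearMap.det_prod_fst_snd_add_comp_fst _
  have hkick : LinearMap.det kick = 1 := LinearMap.det_prod_fst_add_comp_snd_snd _
  rw [hD.fderiv, hfactor]
  simp only [LinearMap.det_comp, hscale, hdrift, hkick, one_mul]
  rw [← Real.exp_nat_mul, ← Real.exp_add]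
  ring_nf
end

section
/- Let t > 0 be real, d ≥ 1 an integer, and let U : ℝ^d → ℝ be twice continuously differentiable with gradient ∇U. Define F : ℝ^d × ℝ^d → ℝ^d × ℝ^d by F(K, Φ) = (K₊, Φ₊) where K₁ = K, Φ₁ = Φ − (t/2)·K₁, K₂ = K₁ + t·∇U(Φ₁), K₊ = K₂, Φ₊ = Φ₁ + (t/2)·K₂ (the quasi-symplectic step with ν = 0). Then for every point z ∈ ℝ^d × ℝ^d, the matrix M of the total derivative of F at z (as a 2d × 2d real matrix in block coordinates (K, Φ)) satisfies Mᵀ J M = J, where J is the standard symplectic matrix with blocks J = [[0, I_d], [−I_d, 0]]; i.e., M lies in the symplectic group. -/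
open Matrix

/-- The deterministic quasi-symplectic Langevin integrator step with zero damping
(`ν = 0`), time step `t` and force field the gradient of a potential `U`:
`K₁ = K`, `Φ₁ = Φ − (t/2)•K₁`, `K₂ = K₁ + t•∇U(Φ₁)`, `K₊ = K₂`,
`Φ₊ = Φ₁ + (t/2)•K₂`. -/
noncomputable def qslStepGrad (d : ℕ) (t : ℝ)
    (U : EuclideanSpace ℝ (Fin d) → ℝ) :
    EuclideanSpace ℝ (Fin d) × EuclideanSpace ℝ (Fin d) →
      EuclideanSpace ℝ (Fin d) × EuclideanSpace ℝ (Fin d) :=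
  fun z =>
    let K₁ := z.1
    let Φ₁ := z.2 - (t / 2) • K₁
    let K₂ := K₁ + t • gradient U Φ₁
    (K₂, Φ₁ + (t / 2) • K₂)

/-- The standard symplectic matrix `J = [[0, I_d], [−I_d, 0]]` in block
coordinates `(K, Φ)`. -/
def symplJ (d : ℕ) : Matrix (Fin d ⊕ Fin d) (Fin d ⊕ Fin d) ℝ :=
  Matrix.fromBlocks 0 1 (-1) 0

section QuasiSymplectic

variable {d : ℕ}

theorem symplJ_eq_neg_J (d : ℕ) : symplJ d = -J (Fin d) ℝ := by
  simp [symplJ, J, fromBlocks_neg]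

theorem fromBlocks_one_zero_mem_symplecticGroup {C : Matrix (Fin d) (Fin d) ℝ} (hC : C.IsSymm) :
    fromBlocks 1 0 C 1 ∈ symplecticGroup (Fin d) ℝ := by
  rw [SymplecticGroup.mem_iff]
  simp [J, fromBlocks_transpose, fromBlocks_multiply, hC.eq]

theorem fromBlocks_one_one_mem_symplecticGroup {B : Matrix (Fin d) (Fin d) ℝ} (hB : B.IsSymm) :
    fromBlocks 1 B 0 1 ∈ symplecticGroup (Fin d) ℝ := by
  rw [SymplecticGroup.mem_iff]
  simp [J, fromBlocks_transpose, fromBlocks_multiply, hB.eq]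

section Gradient

variable {E : Type*} [NormedAddCommGroup E] [InnerProductSpace ℝ E] [CompleteSpace E]

/-- The gradient of a `C²` function has the Hessian as its derivative, a symmetric operator. -/
theorem ContDiffAt.exists_hasFDerivAt_gradient {U : E → ℝ} {x : E} (hU : ContDiffAt ℝ 2 U x) :
    ∃ H : E →L[ℝ] E, HasFDerivAt (gradient U) H x ∧ (H : E →ₗ[ℝ] E).IsSymmetric := by
  have hd : DifferentiableAt ℝ (fderiv ℝ U) x :=
    (hU.fderiv_right (m := 1) (by norm_num)).differentiableAt (by norm_num)
  let R : StrongDual ℝ E →L[ℝ] E :=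
    { toFun := (InnerProductSpace.toDual ℝ E).symm
      map_add' := map_add _
      map_smul' := by simp
      cont := (InnerProductSpace.toDual ℝ E).symm.continuous }
  refine ⟨R ∘L fderiv ℝ (fderiv ℝ U) x, R.hasFDerivAt.comp x hd.hasFDerivAt, fun v w => ?_⟩
  have h := (hU.isSymmSndFDerivAt (by simp)).eq v w
  rw [real_inner_comm _ v]
  simpa [R] using h

end Gradient

section Shear

variable {E : Type*} [NormedAddCommGroup E] [NormedSpace ℝ E]

/-- The shear `(k, φ) ↦ (k, φ + A k)`. -/
def driftShear (A : E →L[ℝ] E) : E × E →L[ℝ] E × E :=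
  (ContinuousLinearMap.fst ℝ E E).prod
    (ContinuousLinearMap.snd ℝ E E + A ∘L ContinuousLinearMap.fst ℝ E E)

/-- The shear `(k, φ) ↦ (k + A φ, φ)`. -/
def kickShear (A : E →L[ℝ] E) : E × E →L[ℝ] E × E :=
  (ContinuousLinearMap.fst ℝ E E + A ∘L ContinuousLinearMap.snd ℝ E E).prod
    (ContinuousLinearMap.snd ℝ E E)

theorem toMatrix_driftShear (b : Module.Basis (Fin d) ℝ E) (A : E →L[ℝ] E) :
    LinearMap.toMatrix (b.prod b) (b.prod b) (driftShear A : E × E →ₗ[ℝ] E × E) =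
      fromBlocks 1 0 (LinearMap.toMatrix b b A) 1 := by
  ext (i | i) (j | j) <;>
    simp [driftShear, LinearMap.toMatrix_apply, Matrix.one_apply, Finsupp.single_apply, eq_comm]

theorem toMatrix_kickShear (b : Module.Basis (Fin d) ℝ E) (A : E →L[ℝ] E) :
    LinearMap.toMatrix (b.prod b) (b.prod b) (kickShear A : E × E →ₗ[ℝ] E × E) =
      fromBlocks 1 (LinearMap.toMatrix b b A) 0 1 := by
  ext (i | i) (j | j) <;>
    simp [kickShear, LinearMap.toMatrix_apply, Matrix.one_apply, Finsupp.single_apply, eq_comm]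

end Shear

theorem hasFDerivAt_qslStepGrad {t : ℝ} {U : EuclideanSpace ℝ (Fin d) → ℝ}
    {z : EuclideanSpace ℝ (Fin d) × EuclideanSpace ℝ (Fin d)}
    {H : EuclideanSpace ℝ (Fin d) →L[ℝ] EuclideanSpace ℝ (Fin d)}
    (hH : HasFDerivAt (gradient U) H (z.2 - (t / 2) • z.1)) :
    HasFDerivAt (qslStepGrad d t U)
      (driftShear ((t / 2) • .id ℝ _) ∘L kickShear (t • H) ∘L driftShear (-(t / 2) • .id ℝ _))
      z := by
  have h₁ : HasFDerivAt (fun y : EuclideanSpace ℝ (Fin d) × EuclideanSpace ℝ (Fin d) =>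
      y.2 - (t / 2) • y.1) _ z :=
    hasFDerivAt_snd.sub ((hasFDerivAt_fst (𝕜 := ℝ) (p := z)).const_smul (t / 2))
  have h₂ := (hasFDerivAt_fst (𝕜 := ℝ) (p := z)).add ((hH.comp z h₁).const_smul t)
  refine (h₂.prodMk (h₁.add (h₂.const_smul (t / 2)))).congr_fderiv ?_
  ext v i <;> simp [driftShear, kickShear]

end QuasiSymplectic

/-- Theorem 1: with `ν = 0` the quasi-symplectic Langevin step is symplectic.
The matrix `M` of its total derivative at any point, expressed in the standard
basis of `ℝ^d × ℝ^d`, satisfies `Mᵀ J M = J`. -/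
theorem qsl_symplectic (d : ℕ) (hd : 1 ≤ d) (t : ℝ) (ht : 0 < t)
    (U : EuclideanSpace ℝ (Fin d) → ℝ) (hU : ContDiff ℝ 2 U)
    (z : EuclideanSpace ℝ (Fin d) × EuclideanSpace ℝ (Fin d)) :
    let b := (EuclideanSpace.basisFun (Fin d) ℝ).toBasis
    let M := LinearMap.toMatrix (b.prod b) (b.prod b)
      (fderiv ℝ (qslStepGrad d t U) z).toLinearMap
    Mᵀ * symplJ d * M = symplJ d := by
  intro b M
  obtain ⟨H, hH, hsymm⟩ :=
    (hU.contDiffAt (x := z.2 - (t / 2) • z.1)).exists_hasFDerivAt_gradient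
  have hHt : (LinearMap.toMatrix b b (H : _ →ₗ[ℝ] _)).IsSymm := by
    simpa [IsHermitian, IsSymm, conjTranspose_eq_transpose_of_trivial, b] using
      (LinearMap.isHermitian_toMatrix_iff (EuclideanSpace.basisFun (Fin d) ℝ)).2 hsymm
  have hM : M ∈ symplecticGroup (Fin d) ℝ := by
    simp only [M, (hasFDerivAt_qslStepGrad hH).fderiv, ContinuousLinearMap.toLinearMap_comp,
      LinearMap.toMatrix_comp _ (b.prod b) _, toMatrix_driftShear, toMatrix_kickShear]
    have hid (s : ℝ) : (LinearMap.toMatrix b b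
        ((s • .id ℝ _ : EuclideanSpace ℝ (Fin d) →L[ℝ] EuclideanSpace ℝ (Fin d)) :
          _ →ₗ[ℝ] _)).IsSymm := by
      simp [IsSymm]
    refine mul_mem (fromBlocks_one_zero_mem_symplecticGroup (hid _))
      (mul_mem (fromBlocks_one_one_mem_symplecticGroup ?_)
        (fromBlocks_one_zero_mem_symplecticGroup (hid _)))
    simpa using hHt.smul t
  simpa [symplJ_eq_neg_J] using SymplecticGroup.mem_iff'.1 hM
end

section
/- Let t > 0 be real, d ≥ 1 an integer, and let g : ℝ^d → ℝ^d be continuously differentiable. Define F : ℝ^d × ℝ^d → ℝ^d × ℝ^d by F(K, Φ) = (K₊, Φ₊) where K₁ = K, Φ₁ = Φ − (t/2)·K₁, K₂ = K₁ + t·g(Φ₁), K₊ = K₂, Φ₊ = Φ₁ + (t/2)·K₂ (the quasi-symplectic step with ν = 0). Then for every point z ∈ ℝ^d × ℝ^d, the determinant of the total derivative of F at z equals 1. -/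
/-- The deterministic quasi-symplectic Langevin integrator step with zero damping
(`ν = 0`), time step `t` and force field `g`: `K₁ = K`, `Φ₁ = Φ − (t/2)•K₁`,
`K₂ = K₁ + t•g(Φ₁)`, `K₊ = K₂`, `Φ₊ = Φ₁ + (t/2)•K₂`. -/
noncomputable def qslStep0 (d : ℕ) (t : ℝ)
    (g : EuclideanSpace ℝ (Fin d) → EuclideanSpace ℝ (Fin d)) :
    EuclideanSpace ℝ (Fin d) × EuclideanSpace ℝ (Fin d) →
      EuclideanSpace ℝ (Fin d) × EuclideanSpace ℝ (Fin d) :=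
  fun z =>
    let K₁ := z.1
    let Φ₁ := z.2 - (t / 2) • K₁
    let K₂ := K₁ + t • g Φ₁
    (K₂, Φ₁ + (t / 2) • K₂)

namespace LinearMap

variable {R M N : Type*} [CommRing R] [AddCommGroup M] [Module R M] [Module.Free R M]
  [Module.Finite R M] [AddCommGroup N] [Module R N] [Module.Free R N] [Module.Finite R N]

theorem det_lower_shear (f : M →ₗ[R] N) :
    LinearMap.det ((fst R M N).prod (snd R M N + f ∘ₗ fst R M N)) = 1 := by
  classical
  let b := Module.Free.chooseBasis R M
  let c := Module.Free.chooseBasis R N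
  have h : toMatrix (b.prod c) (b.prod c) ((fst R M N).prod (snd R M N + f ∘ₗ fst R M N)) =
      Matrix.fromBlocks 1 0 (toMatrix b c f) 1 := by
    ext (i | i) (j | j) <;>
      simp [toMatrix_apply, Matrix.one_apply, Finsupp.single_apply, eq_comm]
  rw [← det_toMatrix (b.prod c), h, Matrix.det_fromBlocks_zero₁₂]
  simp

theorem det_upper_shear (f : N →ₗ[R] M) :
    LinearMap.det ((fst R M N + f ∘ₗ snd R M N).prod (snd R M N)) = 1 := by
  rw [← det_lower_shear f, ← det_conj _ (LinearEquiv.prodComm R M N)]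
  rfl

end LinearMap

/-- With zero damping the quasi-symplectic Langevin step has unit Jacobian
determinant at every point (volume preservation, underlying Theorem 1). -/
theorem qsl_jacobian_det_undamped (d : ℕ) (hd : 1 ≤ d) (t : ℝ) (ht : 0 < t)
    (g : EuclideanSpace ℝ (Fin d) → EuclideanSpace ℝ (Fin d)) (hg : ContDiff ℝ 1 g)
    (z : EuclideanSpace ℝ (Fin d) × EuclideanSpace ℝ (Fin d)) :
    LinearMap.det (fderiv ℝ (qslStep0 d t g) z).toLinearMap = 1 := by
  let E := EuclideanSpace ℝ (Fin d)
  let p := ContinuousLinearMap.fst ℝ E E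
  let q := ContinuousLinearMap.snd ℝ E E
  let w : E × E → E := fun x => x.2 - (t / 2) • x.1
  let A := fderiv ℝ g (w z)
  let w' := q - (t / 2) • p
  let k' := p + t • A ∘L w'
  have hw : HasFDerivAt w w' z := hasFDerivAt_snd.sub (hasFDerivAt_fst.const_smul (t / 2))
  have hA : HasFDerivAt g A (w z) := (hg.differentiable one_ne_zero _).hasFDerivAt
  have hk : HasFDerivAt (fun x => x.1 + t • g (w x)) k' z :=
    hasFDerivAt_fst.add ((hA.comp z hw).const_smul t)
  have hF : HasFDerivAt (qslStep0 d t g) (k'.prod (w' + (t / 2) • k')) z :=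
    hk.prodMk (hw.add (hk.const_smul (t / 2)))
  let drift (s : ℝ) : E × E →ₗ[ℝ] E × E :=
    (LinearMap.fst ℝ E E).prod (LinearMap.snd ℝ E E + (s • LinearMap.id) ∘ₗ LinearMap.fst ℝ E E)
  let kick : E × E →ₗ[ℝ] E × E :=
    (LinearMap.fst ℝ E E + (t • A.toLinearMap) ∘ₗ LinearMap.snd ℝ E E).prod (LinearMap.snd ℝ E E)
  have hfactor : (k'.prod (w' + (t / 2) • k')).toLinearMap =
      drift (t / 2) ∘ₗ kick ∘ₗ drift (-(t / 2)) := by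
    refine LinearMap.ext fun x => Prod.ext ?_ ?_ <;>
      simp [drift, kick, k', w', p, q, sub_eq_add_neg]
  rw [hF.fderiv, hfactor, LinearMap.det_comp, LinearMap.det_comp, LinearMap.det_lower_shear,
    LinearMap.det_upper_shear, LinearMap.det_lower_shear, one_mul, one_mul]
end

section
/- Let ν ≥ 0, t > 0 be real numbers, d ≥ 1 an integer, and let g : ℝ^d → ℝ^d be continuously differentiable. Define F : ℝ^d × ℝ^d → ℝ^d × ℝ^d by F(K, Φ) = (K₊, Φ₊) where K₁ = e^{−νt/2}·K, Φ₁ = Φ − (t/2)·K₁, K₂ = K₁ + t·g(Φ₁), K₊ = e^{−νt/2}·K₂, Φ₊ = Φ₁ + (t/2)·K₂. Then the pushforward of Lebesgue measure on ℝ^d × ℝ^d under F equals e^{ν t d} times Lebesgue measure. -/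
open MeasureTheory

/-- The shear `(x, y) ↦ (x, y + f x)` preserves the product of a measure with a
translation-invariant one. -/
theorem measurePreserving_shear_snd {α G : Type*} [MeasurableSpace α] [MeasurableSpace G]
    [AddGroup G] [MeasurableAdd₂ G] (μ : Measure α) (ρ : Measure G) [SFinite μ] [SFinite ρ]
    [ρ.IsAddRightInvariant] {f : α → G} (hf : Measurable f) :
    MeasurePreserving (fun z : α × G => (z.1, z.2 + f z.1)) (μ.prod ρ) (μ.prod ρ) :=
  (MeasurePreserving.id μ).skew_product (g := fun x y => y + f x)
    (measurable_snd.add (hf.comp measurable_fst))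
    (Filter.Eventually.of_forall fun x => map_add_right_eq_self ρ (f x))

/-- The shear `(x, y) ↦ (x + f y, y)` preserves the product of a translation-invariant measure
with another measure. -/
theorem measurePreserving_shear_fst {α G : Type*} [MeasurableSpace α] [MeasurableSpace G]
    [AddGroup G] [MeasurableAdd₂ G] (μ : Measure α) (ρ : Measure G) [SFinite μ] [SFinite ρ]
    [ρ.IsAddRightInvariant] {f : α → G} (hf : Measurable f) :
    MeasurePreserving (fun z : G × α => (z.1 + f z.2, z.2)) (ρ.prod μ) (ρ.prod μ) :=
  Measure.measurePreserving_swap.comp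
    ((measurePreserving_shear_snd μ ρ hf).comp Measure.measurePreserving_swap)

/-- Scaling the first factor by `c ≠ 0` scales a product measure by `|c ^ dim|⁻¹`. -/
theorem map_smul_fst_prod {E α : Type*} [NormedAddCommGroup E] [NormedSpace ℝ E]
    [MeasurableSpace E] [BorelSpace E] [FiniteDimensional ℝ E] [MeasurableSpace α]
    (μ : Measure E) [μ.IsAddHaarMeasure] (ρ : Measure α) [SFinite ρ] {c : ℝ} (hc : c ≠ 0) :
    Measure.map (fun z : E × α => (c • z.1, z.2)) (μ.prod ρ) =
      ENNReal.ofReal |(c ^ Module.finrank ℝ E)⁻¹| • μ.prod ρ := by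
  have h := Measure.map_prod_map μ ρ (measurable_const_smul c) measurable_id
  rw [Measure.map_id, Measure.map_addHaar_smul μ hc, Measure.prod_smul_left] at h
  exact h.symm

/-- Quasi-volume invariance: the pushforward of Lebesgue measure on phase space
under the quasi-symplectic Langevin step equals `e^{ν t d}` times Lebesgue
measure. -/
theorem qsl_pushforward_volume (d : ℕ) (hd : 1 ≤ d) (ν t : ℝ) (hν : 0 ≤ ν)
    (ht : 0 < t)
    (g : EuclideanSpace ℝ (Fin d) → EuclideanSpace ℝ (Fin d)) (hg : ContDiff ℝ 1 g) :
    Measure.map (qslStep d ν t g)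
        (volume : Measure (EuclideanSpace ℝ (Fin d) × EuclideanSpace ℝ (Fin d))) =
      ENNReal.ofReal (Real.exp (ν * t * d)) • volume := by
  let E := EuclideanSpace ℝ (Fin d)
  set c := Real.exp (-ν * t / 2) with hc
  let S : E × E → E × E := fun z => (c • z.1, z.2)
  have hS : Measurable S := by fun_prop
  have hS_map : Measure.map S volume = ENNReal.ofReal (Real.exp (ν * t * d / 2)) • volume := by
    have h := map_smul_fst_prod (volume : Measure E) (volume : Measure E)
      (Real.exp_ne_zero _ : c ≠ 0)
    have h_exp : |(c ^ Module.finrank ℝ E)⁻¹| = Real.exp (ν * t * d / 2) := by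
      rw [finrank_euclideanSpace_fin, abs_of_pos (by positivity), hc, ← Real.exp_nat_mul,
        ← Real.exp_neg]
      congr 1
      ring
    rwa [h_exp] at h
  have h_kick := measurePreserving_shear_fst (volume : Measure E) (volume : Measure E)
    (f := fun y => t • g y) (hg.continuous.measurable.const_smul t)
  have h_drift (s : ℝ) := measurePreserving_shear_snd (volume : Measure E) (volume : Measure E)
    (f := fun x => s • x) (measurable_const_smul s)
  let M : E × E → E × E := (fun z => (z.1, z.2 + (t / 2) • z.1)) ∘
    (fun z => (z.1 + t • g z.2, z.2)) ∘ fun z => (z.1, z.2 + -(t / 2) • z.1)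
  have hM : MeasurePreserving M volume volume :=
    (h_drift (t / 2)).comp (h_kick.comp (h_drift (-(t / 2))))
  have h_step : qslStep d ν t g = S ∘ M ∘ S := by
    funext z
    simp [qslStep, S, M, hc, sub_eq_add_neg]
  rw [h_step, ← Measure.map_map hS (hM.measurable.comp hS), ← Measure.map_map hM.measurable hS,
    hS_map, Measure.map_smul, hM.map_eq, Measure.map_smul, hS_map, smul_smul,
    ← ENNReal.ofReal_mul (Real.exp_nonneg _), ← Real.exp_add, add_halves]
end

section
/- Let ν ≥ 0, t > 0 be real numbers, d ≥ 1 and I ≥ 1 integers, and let g : ℝ^d → ℝ^d be continuously differentiable. Define F : ℝ^d × ℝ^d → ℝ^d × ℝ^d by F(K, Φ) = (K₊, Φ₊) where K₁ = e^{−νt/2}·K, Φ₁ = Φ − (t/2)·K₁, K₂ = K₁ + t·g(Φ₁), K₊ = e^{−νt/2}·K₂, Φ₊ = Φ₁ + (t/2)·K₂, and let F^[I] denote its I-fold iterate. Then for every measurable function p̂ : ℝ^d × ℝ^d → [0, ∞], the (Lebesgue) integral over ℝ^d × ℝ^d of z ↦ p̂(F^[I](z)) · e^{−I ν t d} equals the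 integral of p̂ over ℝ^d × ℝ^d. -/
open MeasureTheory

/-- Shears along the second factor preserve a product of invariant measures. -/
theorem lintegral_prod_shear_right {E F : Type*} [MeasurableSpace E]
    [AddGroup F] [MeasurableSpace F] [MeasurableAdd₂ F] (μ : Measure E) [SFinite μ]
    (η : Measure F) [SFinite η]
    [η.IsAddRightInvariant] {f : E → F} (hf : Measurable f) {p : E × F → ENNReal}
    (hp : Measurable p) :
    ∫⁻ z, p (z.1, z.2 + f z.1) ∂(μ.prod η) = ∫⁻ z, p z ∂(μ.prod η) := by
  rw [lintegral_prod _ (by fun_prop), lintegral_prod _ hp.aemeasurable]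
  exact lintegral_congr fun x => lintegral_add_right_eq_self (fun y => p (x, y)) (f x)

/-- Shears along the first factor preserve a product of invariant measures. -/
theorem lintegral_prod_shear_left {E F : Type*} [AddGroup E] [MeasurableSpace E]
    [MeasurableAdd₂ E] [MeasurableSpace F] (μ : Measure E) [SFinite μ] [μ.IsAddRightInvariant]
    (η : Measure F) [SFinite η] {f : F → E} (hf : Measurable f) {p : E × F → ENNReal}
    (hp : Measurable p) :
    ∫⁻ z, p (z.1 + f z.2, z.2) ∂(μ.prod η) = ∫⁻ z, p z ∂(μ.prod η) := by
  rw [lintegral_prod_symm _ (by fun_prop), lintegral_prod_symm _ hp.aemeasurable]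
  exact lintegral_congr fun y => lintegral_add_right_eq_self (fun x => p (x, y)) (f y)

/-- Change of variables for a homothety of positive ratio. -/
theorem lintegral_comp_smul_mul_pow_finrank {E : Type*} [NormedAddCommGroup E]
    [NormedSpace ℝ E] [FiniteDimensional ℝ E] [MeasurableSpace E] [BorelSpace E]
    (μ : Measure E) [μ.IsAddHaarMeasure] {c : ℝ} (hc : 0 < c) {p : E → ENNReal}
    (hp : Measurable p) :
    (∫⁻ x, p (c • x) ∂μ) * ENNReal.ofReal (c ^ Module.finrank ℝ E) = ∫⁻ x, p x ∂μ := by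
  have hpow : 0 < c ^ Module.finrank ℝ E := by positivity
  rw [← lintegral_map hp (measurable_const_smul c), Measure.map_addHaar_smul μ hc.ne',
    lintegral_smul_measure, smul_eq_mul, mul_right_comm, abs_of_pos (inv_pos.2 hpow),
    ← ENNReal.ofReal_mul (inv_pos.2 hpow).le, inv_mul_cancel₀ hpow.ne', ENNReal.ofReal_one,
    one_mul]

/-- Change of variables for a homothety of positive ratio of the first factor. -/
theorem lintegral_prod_comp_smul_fst_mul_pow_finrank {E F : Type*}
    [NormedAddCommGroup E] [NormedSpace ℝ E] [FiniteDimensional ℝ E] [MeasurableSpace E]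
    [BorelSpace E] [MeasurableSpace F]
    (μ : Measure E) [SFinite μ] [μ.IsAddHaarMeasure] (η : Measure F) [SFinite η] {c : ℝ}
    (hc : 0 < c) {p : E × F → ENNReal} (hp : Measurable p) :
    (∫⁻ z, p (c • z.1, z.2) ∂(μ.prod η)) * ENNReal.ofReal (c ^ Module.finrank ℝ E) =
      ∫⁻ z, p z ∂(μ.prod η) := by
  have hq : Measurable fun z : E × F => p (c • z.1, z.2) := by fun_prop
  rw [lintegral_prod_symm _ hq.aemeasurable, lintegral_prod_symm _ hp.aemeasurable,
    ← lintegral_mul_const _ hq.lintegral_prod_left']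
  exact lintegral_congr fun y =>
    lintegral_comp_smul_mul_pow_finrank μ hc (p := fun x => p (x, y)) (by fun_prop)

theorem measurable_qslStep (d : ℕ) (ν t : ℝ)
    {g : EuclideanSpace ℝ (Fin d) → EuclideanSpace ℝ (Fin d)} (hg : Measurable g) :
    Measurable (qslStep d ν t g) := by
  unfold qslStep
  fun_prop

/-- Change of variables along one step: the Jacobian determinant is `e^{−νtd}`. -/
theorem lintegral_comp_qslStep_mul_exp (d : ℕ) (ν t : ℝ)
    {g : EuclideanSpace ℝ (Fin d) → EuclideanSpace ℝ (Fin d)} (hg : Measurable g)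
    {p : EuclideanSpace ℝ (Fin d) × EuclideanSpace ℝ (Fin d) → ENNReal} (hp : Measurable p) :
    (∫⁻ z, p (qslStep d ν t g z)) * ENNReal.ofReal (Real.exp (-(ν * t * d))) = ∫⁻ w, p w := by
  set c := Real.exp (-ν * t / 2) with hc
  have hc0 : 0 < c := Real.exp_pos _
  have hJ : ENNReal.ofReal (Real.exp (-(ν * t * d))) =
      ENNReal.ofReal (c ^ d) * ENNReal.ofReal (c ^ d) := by
    rw [← ENNReal.ofReal_mul (by positivity), hc, ← Real.exp_nat_mul, ← Real.exp_add]
    ring_nf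
  have scale {q : EuclideanSpace ℝ (Fin d) × EuclideanSpace ℝ (Fin d) → ENNReal}
      (hq : Measurable q) :
      (∫⁻ z : EuclideanSpace ℝ (Fin d) × EuclideanSpace ℝ (Fin d), q (c • z.1, z.2)) *
        ENNReal.ofReal (c ^ d) = ∫⁻ z, q z := by
    simpa only [finrank_euclideanSpace_fin, Measure.volume_eq_prod] using
      lintegral_prod_comp_smul_fst_mul_pow_finrank volume volume hc0 hq
  let p₁ := fun z : EuclideanSpace ℝ (Fin d) × EuclideanSpace ℝ (Fin d) => p (c • z.1, z.2)
  let p₂ := fun z : EuclideanSpace ℝ (Fin d) × EuclideanSpace ℝ (Fin d) =>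
    p₁ (z.1, z.2 + (t / 2) • z.1)
  let p₃ := fun z : EuclideanSpace ℝ (Fin d) × EuclideanSpace ℝ (Fin d) =>
    p₂ (z.1 + t • g z.2, z.2)
  let p₄ := fun z : EuclideanSpace ℝ (Fin d) × EuclideanSpace ℝ (Fin d) =>
    p₃ (z.1, z.2 + -((t / 2) • z.1))
  have hp₁ : Measurable p₁ := by fun_prop
  have hp₂ : Measurable p₂ := by fun_prop
  have hp₃ : Measurable p₃ := by fun_prop
  have hp₄ : Measurable p₄ := by fun_prop
  have hstep (z) : p (qslStep d ν t g z) = p₄ (c • z.1, z.2) := by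
    simp only [p₄, p₃, p₂, p₁, qslStep, ← hc, sub_eq_add_neg]
  calc (∫⁻ z, p (qslStep d ν t g z)) * ENNReal.ofReal (Real.exp (-(ν * t * d)))
      = (∫⁻ z, p₄ z) * ENNReal.ofReal (c ^ d) := by
        simp only [hstep]
        rw [hJ, ← mul_assoc, scale hp₄]
    _ = (∫⁻ z, p₃ z) * ENNReal.ofReal (c ^ d) := congrArg (· * _) <|
        lintegral_prod_shear_right volume volume (f := fun x => -((t / 2) • x)) (by fun_prop) hp₃
    _ = (∫⁻ z, p₂ z) * ENNReal.ofReal (c ^ d) := congrArg (· * _) <|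
        lintegral_prod_shear_left volume volume (f := fun y => t • g y) (by fun_prop) hp₂
    _ = (∫⁻ z, p₁ z) * ENNReal.ofReal (c ^ d) := congrArg (· * _) <|
        lintegral_prod_shear_right volume volume (f := fun x => (t / 2) • x) (by fun_prop) hp₁
    _ = ∫⁻ w, p w := scale hp

/-- Unbiasedness of the Jacobian-corrected change of variables along the
`I`-step quasi-symplectic Langevin flow: for every measurable `p̂ ≥ 0`,
`∫ p̂(F^[I](z)) e^{−I ν t d} dz = ∫ p̂(w) dw`. -/
theorem qsl_flow_change_of_variables (d : ℕ) (hd : 1 ≤ d) (I : ℕ) (hI : 1 ≤ I)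
    (ν t : ℝ) (hν : 0 ≤ ν) (ht : 0 < t)
    (g : EuclideanSpace ℝ (Fin d) → EuclideanSpace ℝ (Fin d)) (hg : ContDiff ℝ 1 g)
    (phat : EuclideanSpace ℝ (Fin d) × EuclideanSpace ℝ (Fin d) → ENNReal)
    (hp : Measurable phat) :
    ∫⁻ z, phat ((qslStep d ν t g)^[I] z) * ENNReal.ofReal (Real.exp (-(I * ν * t * d))) =
      ∫⁻ w, phat w := by
  have hgm : Measurable g := hg.continuous.measurable
  have hF := measurable_qslStep d ν t hgm
  rw [lintegral_mul_const _ (f := fun z => phat ((qslStep d ν t g)^[I] z))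
    (hp.comp (hF.iterate I))]
  clear hI
  induction I with
  | zero => simp
  | succ n ih =>
    have hJ : ENNReal.ofReal (Real.exp (-((n + 1 : ℕ) * ν * t * d))) =
        ENNReal.ofReal (Real.exp (-(ν * t * d))) *
          ENNReal.ofReal (Real.exp (-(n * ν * t * d))) := by
      rw [← ENNReal.ofReal_mul (Real.exp_pos _).le, ← Real.exp_add]
      push_cast
      ring_nf
    simp only [Function.iterate_succ_apply]
    rw [hJ, ← mul_assoc,
      lintegral_comp_qslStep_mul_exp d ν t hgm (p := fun z => phat ((qslStep d ν t g)^[n] z))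
        (hp.comp (hF.iterate n)), ih]
end
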